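/- Fix θ_a ∈ (0,1), κ > 0 and an initial condition (θ₀, p₀) ∈ (0,1)². For decay parameters Δ₁, Δ₂ with 0 < Δ₁ ≤ Δ₂, let (θ_i(t), p_i(t)) denote the solution of θ' = θ(1−θ)((1−p)(1−θ) − Δ_i pθ), p' = κ p(1−p)((1−θ)² − (1−θ_a)²) started at (θ₀, p₀). Then for all t ≥ 0, θ₂(t) ≤ θ₁(t) and p₂(t) ≥ p₁(t); i.e., the skill is non-increasing and the delegation is non-decreasing in the decay rate Δ. -/

import Mathlib

open Set

/-- A solution of a scalar linear equation `x' = a x` with continuous coefficient that starts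
positive stays positive. -/
theorem pos_of_hasDerivWithinAt_mul {x a : ℝ → ℝ} (ha : ContinuousOn a (Ici 0))
    (hx : ∀ t ∈ Ici (0 : ℝ), HasDerivWithinAt x (a t * x t) (Ici 0) t) (h0 : 0 < x 0) :
    ∀ t ∈ Ici (0 : ℝ), 0 < x t := by
  intro T hT
  obtain ⟨K, hK⟩ := isCompact_Icc.exists_bound_of_continuousOn
    (ha.mono (Icc_subset_Ici_self : Icc 0 T ⊆ Ici 0))
  have hf : ∀ t, HasDerivAt (fun t ↦ x 0 * Real.exp (-(K + 1) * t))
      (-(K + 1) * (x 0 * Real.exp (-(K + 1) * t))) t := fun t ↦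
    ((((hasDerivAt_id' t).const_mul (-(K + 1))).exp).const_mul (x 0)).congr_deriv (by ring)
  have hle := image_le_of_deriv_right_lt_deriv_boundary' (a := 0) (b := T)
    (fun t _ ↦ (hf t).continuousAt.continuousWithinAt) (fun t _ ↦ (hf t).hasDerivWithinAt)
    (B := x) (B' := fun t ↦ a t * x t) (by simp)
    (fun t ht ↦ (hx t ht.1).continuousWithinAt.mono Icc_subset_Ici_self)
    (fun t ht ↦ (hx t ht.1).mono (Ici_subset_Ici.2 ht.1))
    (fun t ht heq ↦ by
      have hpos : 0 < x t := heq ▸ mul_pos h0 (Real.exp_pos _)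
      have hb := (abs_le.1 (hK t ⟨ht.1, ht.2.le⟩)).1
      rw [heq]
      exact mul_lt_mul_of_pos_right (by linarith) hpos)
  exact (mul_pos h0 (Real.exp_pos _)).trans_le (hle ⟨hT, le_rfl⟩)

/-- A solution of a logistic equation `x' = x (1 - x) g` with continuous coefficient that starts
in the open unit interval stays there. -/
theorem mem_Ioo_of_hasDerivWithinAt_logistic {x g : ℝ → ℝ} (hg : ContinuousOn g (Ici 0))
    (hx : ∀ t ∈ Ici (0 : ℝ), HasDerivWithinAt x (x t * (1 - x t) * g t) (Ici 0) t)
    (h0 : x 0 ∈ Ioo (0 : ℝ) 1) : ∀ t ∈ Ici (0 : ℝ), x t ∈ Ioo (0 : ℝ) 1 := by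
  have hc : ContinuousOn x (Ici 0) := fun t ht ↦ (hx t ht).continuousWithinAt
  have hpos := pos_of_hasDerivWithinAt_mul (x := x) (a := fun t ↦ (1 - x t) * g t)
    (by fun_prop) (fun t ht ↦ (hx t ht).congr_deriv (by ring)) h0.1
  have hlt := pos_of_hasDerivWithinAt_mul (x := fun t ↦ 1 - x t) (a := fun t ↦ -(x t * g t))
    (by fun_prop) (fun t ht ↦ ((hx t ht).const_sub 1).congr_deriv (by ring)) (sub_pos.2 h0.2)
  exact fun t ht ↦ ⟨hpos t ht, sub_pos.1 (hlt t ht)⟩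

theorem hasDerivAt_min_zero_sq (x : ℝ) :
    HasDerivAt (fun y : ℝ ↦ min y 0 ^ 2) (2 * min x 0) x := by
  rcases lt_trichotomy x 0 with hx | rfl | hx
  · rw [min_eq_left hx.le]
    refine HasDerivAt.congr_of_eventuallyEq (by simpa using hasDerivAt_pow 2 x) ?_
    filter_upwards [Iio_mem_nhds hx] with y hy
    rw [min_eq_left (le_of_lt hy)]
  · have hsq : HasDerivAt (fun y : ℝ ↦ y ^ 2) 0 0 := by simpa using hasDerivAt_pow 2 (0 : ℝ)
    rw [hasDerivAt_iff_isLittleO] at hsq ⊢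
    refine Asymptotics.IsBigO.trans_isLittleO (.of_bound 1 (.of_forall fun y ↦ ?_)) hsq
    rcases le_total y 0 with hy | hy
    · simp [hy]
    · simp [hy]
  · rw [min_eq_right hx.le, mul_zero]
    refine (hasDerivAt_const x (0 : ℝ)).congr_of_eventuallyEq ?_
    filter_upwards [Ioi_mem_nhds hx] with y hy
    simp [min_eq_right (le_of_lt (mem_Ioi.1 hy))]

/-- Kamke-type comparison for planar linear systems: a solution of `u' = A u + B v + C`,
`v' = D u + E v` with nonnegative off-diagonal coefficients and forcing that starts in the
nonnegative quadrant stays there. -/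
theorem nonneg_of_cooperative_linear {u v A B C D E : ℝ → ℝ}
    (hA : ContinuousOn A (Ici 0)) (hB : ContinuousOn B (Ici 0)) (hD : ContinuousOn D (Ici 0))
    (hE : ContinuousOn E (Ici 0)) (hB0 : ∀ t ∈ Ici (0 : ℝ), 0 ≤ B t)
    (hC0 : ∀ t ∈ Ici (0 : ℝ), 0 ≤ C t) (hD0 : ∀ t ∈ Ici (0 : ℝ), 0 ≤ D t)
    (hu : ∀ t ∈ Ici (0 : ℝ), HasDerivWithinAt u (A t * u t + B t * v t + C t) (Ici 0) t)
    (hv : ∀ t ∈ Ici (0 : ℝ), HasDerivWithinAt v (D t * u t + E t * v t) (Ici 0) t)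
    (hu0 : 0 ≤ u 0) (hv0 : 0 ≤ v 0) : ∀ t ∈ Ici (0 : ℝ), 0 ≤ u t ∧ 0 ≤ v t := by
  intro T hT
  have hcoef : ContinuousOn (fun t ↦ 2 * |A t| + B t + D t + 2 * |E t|) (Icc 0 T) :=
    ContinuousOn.mono (by fun_prop) Icc_subset_Ici_self
  obtain ⟨K, hK⟩ := isCompact_Icc.exists_bound_of_continuousOn hcoef
  have hφ : ∀ t ∈ Ici (0 : ℝ), HasDerivWithinAt (fun t ↦ min (u t) 0 ^ 2 + min (v t) 0 ^ 2)
      (2 * min (u t) 0 * (A t * u t + B t * v t + C t)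
        + 2 * min (v t) 0 * (D t * u t + E t * v t)) (Ici 0) t := fun t ht ↦
    ((hasDerivAt_min_zero_sq (u t)).comp_hasDerivWithinAt t (hu t ht)).add
      ((hasDerivAt_min_zero_sq (v t)).comp_hasDerivWithinAt t (hv t ht))
  have hle := le_gronwallBound_of_liminf_deriv_right_le (a := 0) (b := T) (δ := 0) (K := K)
    (ε := 0) (fun t ht ↦ (hφ t ht.1).continuousWithinAt.mono Icc_subset_Ici_self)
    (fun t ht r hr ↦ ((hφ t ht.1).mono (Ici_subset_Ici.2 ht.1)).liminf_right_slope_le hr)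
    (by simp [hu0, hv0])
    (fun t ht ↦ by
      have hKt := (abs_le.1 (hK t ⟨ht.1, ht.2.le⟩)).2
      have hB := hB0 t ht.1
      have hC := hC0 t ht.1
      have hD := hD0 t ht.1
      have self_mul : ∀ y : ℝ, min y 0 * y = min y 0 ^ 2 := fun y ↦ by
        rcases le_total y 0 with hy | hy <;> simp [hy, sq]
      have hmu := self_mul (u t)
      have hmv := self_mul (v t)
      have hu1 := min_le_left (u t) 0
      have hv1 := min_le_left (v t) 0
      have hu2 := min_le_right (u t) 0
      have hv2 := min_le_right (v t) 0
      generalize min (u t) 0 = m at *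
      generalize min (v t) 0 = n at *
      have h1 : A t * m ^ 2 ≤ |A t| * m ^ 2 := by gcongr; exact le_abs_self _
      have h2 : E t * n ^ 2 ≤ |E t| * n ^ 2 := by gcongr; exact le_abs_self _
      have h3 : m * v t ≤ m * n := mul_le_mul_of_nonpos_left hv1 hu2
      have h4 : n * u t ≤ m * n := by nlinarith
      have h5 : 2 * (m * n) ≤ m ^ 2 + n ^ 2 := by nlinarith [sq_nonneg (m - n)]
      have h6 : B t * (m * v t) ≤ B t * (m * n) := by gcongr
      have h7 : D t * (n * u t) ≤ D t * (m * n) := by gcongr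
      have h8 : (B t + D t) * (2 * (m * n)) ≤ (B t + D t) * (m ^ 2 + n ^ 2) := by gcongr
      have h9 : m * C t ≤ 0 := mul_nonpos_of_nonpos_of_nonneg hu2 hC
      have h10 := mul_le_mul_of_nonneg_right hKt (add_nonneg (sq_nonneg m) (sq_nonneg n))
      have h11 : 0 ≤ |A t| * n ^ 2 := by positivity
      have h12 : 0 ≤ |E t| * m ^ 2 := by positivity
      calc 2 * m * (A t * u t + B t * v t + C t) + 2 * n * (D t * u t + E t * v t)
          = 2 * (A t * (m * u t) + B t * (m * v t) + m * C t + D t * (n * u t)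
            + E t * (n * v t)) := by ring
        _ ≤ K * (m ^ 2 + n ^ 2) + 0 := by rw [hmu, hmv]; linarith)
    T ⟨hT, le_rfl⟩
  rw [gronwallBound_ε0_δ0] at hle
  constructor
  · by_contra! h
    rw [min_eq_left h.le] at hle
    nlinarith [sq_nonneg (min (v T) 0), sq_pos_of_neg h]
  · by_contra! h
    rw [min_eq_left h.le] at hle
    nlinarith [sq_nonneg (min (u T) 0), sq_pos_of_neg h]

/-- Monotonicity in the decay rate: for two copies of the coupled
skill–delegation ODE with decay rates `0 < Δ₁ ≤ Δ₂`, started at the same initial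
condition in `(0,1)²`, the skill is pointwise non-increasing and the delegation
pointwise non-decreasing in the decay rate. -/
theorem coupled_ode_monotone_in_decay
    (θa κ : ℝ) (hθa : θa ∈ Ioo (0:ℝ) 1) (hκ : 0 < κ)
    (Δ₁ Δ₂ : ℝ) (hΔ₁ : 0 < Δ₁) (hΔ : Δ₁ ≤ Δ₂)
    (θ0 p0 : ℝ) (h0 : (θ0, p0) ∈ Ioo (0:ℝ) 1 ×ˢ Ioo (0:ℝ) 1)
    (θ₁ p₁ θ₂ p₂ : ℝ → ℝ)
    (hinit₁ : θ₁ 0 = θ0 ∧ p₁ 0 = p0) (hinit₂ : θ₂ 0 = θ0 ∧ p₂ 0 = p0)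
    (hode₁ : ∀ t ∈ Ici (0:ℝ),
      HasDerivWithinAt θ₁
        (θ₁ t * (1 - θ₁ t) * ((1 - p₁ t) * (1 - θ₁ t) - Δ₁ * p₁ t * θ₁ t)) (Ici 0) t ∧
      HasDerivWithinAt p₁
        (κ * p₁ t * (1 - p₁ t) * ((1 - θ₁ t) ^ 2 - (1 - θa) ^ 2)) (Ici 0) t)
    (hode₂ : ∀ t ∈ Ici (0:ℝ),
      HasDerivWithinAt θ₂
        (θ₂ t * (1 - θ₂ t) * ((1 - p₂ t) * (1 - θ₂ t) - Δ₂ * p₂ t * θ₂ t)) (Ici 0) t ∧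
      HasDerivWithinAt p₂
        (κ * p₂ t * (1 - p₂ t) * ((1 - θ₂ t) ^ 2 - (1 - θa) ^ 2)) (Ici 0) t) :
    ∀ t ∈ Ici (0:ℝ), θ₂ t ≤ θ₁ t ∧ p₁ t ≤ p₂ t := by
  rw [mem_prod] at h0
  obtain ⟨hθ₁0, hp₁0⟩ := hinit₁
  obtain ⟨hθ₂0, hp₂0⟩ := hinit₂
  have cθ₁ : ContinuousOn θ₁ (Ici 0) := fun t ht ↦ (hode₁ t ht).1.continuousWithinAt
  have cp₁ : ContinuousOn p₁ (Ici 0) := fun t ht ↦ (hode₁ t ht).2.continuousWithinAt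
  have cθ₂ : ContinuousOn θ₂ (Ici 0) := fun t ht ↦ (hode₂ t ht).1.continuousWithinAt
  have cp₂ : ContinuousOn p₂ (Ici 0) := fun t ht ↦ (hode₂ t ht).2.continuousWithinAt
  have mθ₁ := mem_Ioo_of_hasDerivWithinAt_logistic (by fun_prop)
    (fun t ht ↦ (hode₁ t ht).1) (hθ₁0 ▸ h0.1)
  have mθ₂ := mem_Ioo_of_hasDerivWithinAt_logistic (by fun_prop)
    (fun t ht ↦ (hode₂ t ht).1) (hθ₂0 ▸ h0.1)
  have mp₂ := mem_Ioo_of_hasDerivWithinAt_logistic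
    (g := fun t ↦ κ * ((1 - θ₂ t) ^ 2 - (1 - θa) ^ 2)) (by fun_prop)
    (fun t ht ↦ (hode₂ t ht).2.congr_deriv (by ring)) (hp₂0 ▸ h0.2)
  have key := nonneg_of_cooperative_linear
    (u := fun t ↦ θ₁ t - θ₂ t) (v := fun t ↦ p₂ t - p₁ t)
    (A := fun t ↦ (1 - p₂ t) * (1 - (θ₁ t + θ₂ t)) - (1 - p₂ t + Δ₁ * p₂ t)
      * (θ₁ t + θ₂ t - (θ₁ t ^ 2 + θ₁ t * θ₂ t + θ₂ t ^ 2)))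
    (B := fun t ↦ θ₁ t * (1 - θ₁ t) * (1 - θ₁ t + Δ₁ * θ₁ t))
    (C := fun t ↦ (Δ₂ - Δ₁) * (θ₂ t ^ 2 * (1 - θ₂ t) * p₂ t))
    (D := fun t ↦ κ * (p₂ t * (1 - p₂ t)) * ((1 - θ₁ t) + (1 - θ₂ t)))
    (E := fun t ↦ κ * (1 - p₁ t - p₂ t) * ((1 - θ₁ t) ^ 2 - (1 - θa) ^ 2))
    (by fun_prop) (by fun_prop) (by fun_prop) (by fun_prop)
    (fun t ht ↦ by
      have h := mθ₁ t ht
      have := h.1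
      have := sub_pos.2 h.2
      positivity)
    (fun t ht ↦ by
      have := sub_pos.2 (mθ₂ t ht).2
      have := (mp₂ t ht).1
      have := sub_nonneg.2 hΔ
      positivity)
    (fun t ht ↦ by
      have := sub_pos.2 (mθ₁ t ht).2
      have := sub_pos.2 (mθ₂ t ht).2
      have := (mp₂ t ht).1
      have := sub_pos.2 (mp₂ t ht).2
      positivity)
    (fun t ht ↦ ((hode₁ t ht).1.sub (hode₂ t ht).1).congr_deriv (by ring))
    (fun t ht ↦ ((hode₂ t ht).2.sub (hode₁ t ht).2).congr_deriv (by ring))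
    (by simp [hθ₁0, hθ₂0]) (by simp [hp₁0, hp₂0])
  exact fun t ht ↦ ⟨sub_nonneg.1 (key t ht).1, sub_nonneg.1 (key t ht).2⟩
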